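/- For every λ ∈ ℕ^t with λ ≠ 0, the element x^λ + y^λ of A is an A_+-linear combination of the elements x^γ + y^γ with γ ∈ {0,1}^t, γ ≠ 0 (i.e. it lies in the ideal of the fixed subring A_+ generated by these 2^t − 1 elements). (Intermediate claim, proved by induction, in the proof of Lemma 2.7.) -/

import Mathlib

noncomputable section

open MvPolynomial

/-- The defining ideal: generated by `x_i y_i + x_i + y_i`, `i = 1,…,t`. -/
def torusRel (R : Type*) [CommRing R] (t : ℕ) : Ideal (MvPolynomial (Fin t ⊕ Fin t) R) :=
  Ideal.span { p | ∃ i : Fin t,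
    p = X (Sum.inl i) * X (Sum.inr i) + X (Sum.inl i) + X (Sum.inr i) }

/-- `A = R[x_1,…,x_t,y_1,…,y_t]/(x_i y_i + x_i + y_i)`. -/
abbrev QA (R : Type*) [CommRing R] (t : ℕ) :=
  MvPolynomial (Fin t ⊕ Fin t) R ⧸ torusRel R t

/-- The image of the variable `x_i` in `A`. -/
def xg (R : Type*) [CommRing R] (t : ℕ) (i : Fin t) : QA R t :=
  Ideal.Quotient.mk _ (X (Sum.inl i))

/-- The image of the variable `y_i` in `A`. -/
def yg (R : Type*) [CommRing R] (t : ℕ) (i : Fin t) : QA R t :=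
  Ideal.Quotient.mk _ (X (Sum.inr i))

/-- `L = R[ℤ^t]`, the group algebra of `ℤ^t` over `R`. -/
abbrev LA (R : Type*) [CommRing R] (t : ℕ) := AddMonoidAlgebra R (Fin t → ℤ)

/-- The basis element `u^ν` of `L = R[ℤ^t]`. -/
def uL (R : Type*) [CommRing R] (t : ℕ) (ν : Fin t → ℤ) : LA R t :=
  AddMonoidAlgebra.single ν 1

/-- `x^λ = ∏_i x_i^{λ_i}` in `A`. -/
def xpow (R : Type*) [CommRing R] (t : ℕ) (lam : Fin t → ℕ) : QA R t :=
  ∏ i : Fin t, xg R t i ^ lam i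

/-- `y^λ = ∏_i y_i^{λ_i}` in `A`. -/
def ypow (R : Type*) [CommRing R] (t : ℕ) (lam : Fin t → ℕ) : QA R t :=
  ∏ i : Fin t, yg R t i ^ lam i

section PowerSums

variable (R : Type*) [CommRing R] (t : ℕ)

/-- The power sum `x^λ + y^λ` in `A`. -/
def powSum (lam : Fin t → ℕ) : QA R t :=
  xpow R t lam + ypow R t lam

variable {R t}

lemma xg_mul_yg (i : Fin t) : xg R t i * yg R t i = -(xg R t i + yg R t i) := by
  rw [eq_neg_iff_add_eq_zero, ← add_assoc]
  exact Ideal.Quotient.eq_zero_iff_mem.mpr (Ideal.subset_span ⟨i, rfl⟩)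

lemma xpow_add (a b : Fin t → ℕ) : xpow R t (a + b) = xpow R t a * xpow R t b := by
  simp [xpow, pow_add, Finset.prod_mul_distrib]

lemma ypow_add (a b : Fin t → ℕ) : ypow R t (a + b) = ypow R t a * ypow R t b := by
  simp [ypow, pow_add, Finset.prod_mul_distrib]

lemma xpow_single (i : Fin t) (n : ℕ) : xpow R t (Pi.single i n) = xg R t i ^ n := by
  rw [xpow, Finset.prod_eq_single i] <;> simp +contextual

lemma ypow_single (i : Fin t) (n : ℕ) : ypow R t (Pi.single i n) = yg R t i ^ n := by
  rw [ypow, Finset.prod_eq_single i] <;> simp +contextual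

lemma powSum_add_single_two (a : Fin t → ℕ) (i : Fin t) :
    powSum R t (a + Pi.single i 2) =
      powSum R t (Pi.single i 1) * (powSum R t (a + Pi.single i 1) + powSum R t a) := by
  simp only [powSum, xpow_add, ypow_add, xpow_single, ypow_single, pow_one]
  linear_combination (-(xpow R t a + ypow R t a)) * xg_mul_yg (R := R) i

lemma powSum_zero : powSum R t 0 = 2 := by
  simp [powSum, xpow, ypow, one_add_one_eq_two]

/-- Over any subalgebra containing the `x_i + y_i`, the power sums with nonzero squarefree exponents
span all power sums with nonzero exponents. -/
lemma powSum_mem_span (S : Subalgebra R (QA R t))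
    (hS : ∀ i, powSum R t (Pi.single i 1) ∈ S) (lam : Fin t → ℕ) (hlam : lam ≠ 0) :
    powSum R t lam ∈ Submodule.span S
      (powSum R t '' {g | g ≠ 0 ∧ ∀ i, g i ≤ 1}) := by
  set M := Submodule.span S (powSum R t '' {g | g ≠ 0 ∧ ∀ i, g i ≤ 1})
  induction h : ∑ i, lam i using Nat.strong_induction_on generalizing lam with
  | _ n ih =>
    by_cases hle : ∀ i, lam i ≤ 1
    · exact Submodule.subset_span ⟨lam, ⟨hlam, hle⟩, rfl⟩
    push Not at hle
    obtain ⟨i, hi⟩ := hle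
    obtain ⟨a, rfl⟩ : ∃ a, lam = a + Pi.single i 2 :=
      ⟨lam - Pi.single i 2, (tsub_add_cancel_of_le <| by
        intro j
        rcases eq_or_ne j i with rfl | hj
        · simpa [Nat.succ_le_iff] using hi
        · simp [hj]).symm⟩
    have hsum (k : ℕ) : ∑ j, (a + Pi.single i k : Fin t → ℕ) j = ∑ j, a j + k := by
      simp [Finset.sum_add_distrib]
    rw [hsum] at h
    have h1 : powSum R t (a + Pi.single i 1) ∈ M :=
      ih _ (by rw [hsum]; omega) _ (fun h0 => by simpa using congrFun h0 i) rfl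
    rw [powSum_add_single_two, mul_add]
    refine add_mem (M.smul_mem ⟨_, hS i⟩ h1) ?_
    rcases eq_or_ne a 0 with rfl | ha
    · rw [powSum_zero, mul_two]
      rw [zero_add] at h1
      exact add_mem h1 h1
    · exact M.smul_mem ⟨_, hS i⟩ (ih _ (by omega) _ ha rfl)

end PowerSums

/-- For `λ ∈ ℕ^t`, `λ ≠ 0`, the element `x^λ + y^λ` is an `A_+`-linear combination
(coefficients fixed by `τ`) of the elements `x^γ + y^γ`, `γ ∈ {0,1}^t − {0}`. -/
theorem stmt7 (R : Type*) [CommRing R] (t : ℕ) (ht : 1 ≤ t)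
    (τ : QA R t ≃ₐ[R] QA R t)
    (hτx : ∀ i : Fin t, τ (xg R t i) = yg R t i)
    (hτy : ∀ i : Fin t, τ (yg R t i) = xg R t i)
    (lam : Fin t → ℕ) (hlam : lam ≠ 0) :
    ∃ c : (Fin t → Fin 2) → QA R t, (∀ γ, τ (c γ) = c γ) ∧
      xpow R t lam + ypow R t lam =
        ∑ γ ∈ Finset.univ.filter (fun γ : Fin t → Fin 2 => γ ≠ 0),
          c γ * (xpow R t (fun i => (γ i : ℕ)) + ypow R t (fun i => (γ i : ℕ))) := by
  let S := AlgHom.equalizer (τ : QA R t →ₐ[R] QA R t) (AlgHom.id R _)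
  have hS (i : Fin t) : powSum R t (Pi.single i 1) ∈ S := by
    change τ _ = _
    simp [powSum, xpow_single, ypow_single, hτx, hτy, add_comm]
  have hmem := powSum_mem_span S hS lam hlam
  have hset : powSum R t '' {g | g ≠ 0 ∧ ∀ i, g i ≤ 1} ⊆
      (fun γ : Fin t → Fin 2 => powSum R t fun i => (γ i : ℕ)) ''
        (Finset.univ.filter (fun γ : Fin t → Fin 2 => γ ≠ 0) : Finset (Fin t → Fin 2)) := by
    rintro _ ⟨g, ⟨hg, hle⟩, rfl⟩
    refine ⟨fun i => ⟨g i, Nat.lt_succ_of_le (hle i)⟩, ?_, rfl⟩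
    simp only [Finset.coe_filter, Finset.mem_univ, true_and, Set.mem_ofPred_eq]
    exact fun h0 => hg (funext fun i => congrArg Fin.val (congrFun h0 i))
  obtain ⟨c, hc⟩ := Submodule.mem_span_image_finset_iff_exists_fun' S |>.mp
    (Submodule.span_mono hset hmem)
  exact ⟨fun γ => c γ, fun γ => (c γ).2, hc.symm⟩
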